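/- arXiv:1204.5276 — 2 statements merged into one kernel-verified Lean document; each statement's English description precedes it below -/
import Mathlib

section
/- For every positive integer n and every α ∈ Sym(n), the number of Latin squares of order n whose first-symbol permutation α_1 equals α and whose symbol-sign is +1 (resp. −1) equals the number of Latin squares of order n whose first column is α and whose column-sign is +1 (resp. −1); that is, L_n^SE(α) = L_n^CE(α) and L_n^SO(α) = L_n^CO(α). -/
/-- `L` is a Latin square of order `n`: every row and every column is a
bijection of `Fin n` (i.e. contains each symbol exactly once). -/
def IsLatin {n : ℕ} (L : Fin n → Fin n → Fin n) : Prop :=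
  (∀ i, Function.Bijective fun j => L i j) ∧ ∀ j, Function.Bijective fun i => L i j

/-- The permutation determined by a bijective function (junk value `1` otherwise). -/
noncomputable def permOf {n : ℕ} (f : Fin n → Fin n) : Equiv.Perm (Fin n) :=
  if h : Function.Bijective f then Equiv.ofBijective f h else 1

/-- The product of the signs of the rows of `L`. -/
noncomputable def rowSign {n : ℕ} (L : Fin n → Fin n → Fin n) : ℤ :=
  ∏ i, (Equiv.Perm.sign (permOf fun j => L i j) : ℤ)

/-- The product of the signs of the columns of `L`. -/
noncomputable def colSign {n : ℕ} (L : Fin n → Fin n → Fin n) : ℤ :=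
  ∏ j, (Equiv.Perm.sign (permOf fun i => L i j) : ℤ)

/-- The sign of a Latin square: row-sign times column-sign. -/
noncomputable def latinSign {n : ℕ} (L : Fin n → Fin n → Fin n) : ℤ :=
  rowSign L * colSign L

/-- The permutation `α_s` of a Latin square `L`: `α_s i = j` iff `L i j = s`. -/
noncomputable def symPerm {n : ℕ} (L : Fin n → Fin n → Fin n) (s : Fin n) :
    Equiv.Perm (Fin n) :=
  permOf fun i => (permOf fun j => L i j).symm s

/-- The symbol-sign of a Latin square: the product of the signs of the `α_s`. -/
noncomputable def symbolSign {n : ℕ} (L : Fin n → Fin n → Fin n) : ℤ :=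
  ∏ s, (Equiv.Perm.sign (symPerm L s) : ℤ)

/-- The number of Latin squares of order `n`. -/
noncomputable def numLatin (n : ℕ) : ℕ :=
  Nat.card {L : Fin n → Fin n → Fin n // IsLatin L}

/-- The number of even Latin squares of order `n`. -/
noncomputable def numLatinEven (n : ℕ) : ℕ :=
  Nat.card {L : Fin n → Fin n → Fin n // IsLatin L ∧ latinSign L = 1}

/-- The number of odd Latin squares of order `n`. -/
noncomputable def numLatinOdd (n : ℕ) : ℕ :=
  Nat.card {L : Fin n → Fin n → Fin n // IsLatin L ∧ latinSign L = -1}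

/-- `L` is normalized: its first row is the identity permutation. -/
def IsNormalized {n : ℕ} (L : Fin n → Fin n → Fin n) : Prop :=
  ∀ j : Fin n, L ⟨0, j.pos⟩ j = j

/-- `L` is unipotent: all entries on the main diagonal are equal. -/
def IsUnipotent {n : ℕ} (L : Fin n → Fin n → Fin n) : Prop :=
  ∀ i k : Fin n, L i i = L k k

/-- The Alon-Tarsi constant `AT(n) = U_n^E - U_n^O`. -/
noncomputable def AT (n : ℕ) : ℤ :=
  (Nat.card {L : Fin n → Fin n → Fin n //
      IsLatin L ∧ IsNormalized L ∧ IsUnipotent L ∧ latinSign L = 1} : ℤ) -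
  (Nat.card {L : Fin n → Fin n → Fin n //
      IsLatin L ∧ IsNormalized L ∧ IsUnipotent L ∧ latinSign L = -1} : ℤ)

/-- `L` is reduced: first row and first column are the identity. -/
def IsReducedLatin {n : ℕ} (L : Fin n → Fin n → Fin n) : Prop :=
  IsNormalized L ∧ ∀ i : Fin n, L i ⟨0, i.pos⟩ = i

/-- The number of even reduced Latin squares of order `n`. -/
noncomputable def numReducedEven (n : ℕ) : ℕ :=
  Nat.card {L : Fin n → Fin n → Fin n // IsLatin L ∧ IsReducedLatin L ∧ latinSign L = 1}

/-- The number of odd reduced Latin squares of order `n`. -/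
noncomputable def numReducedOdd (n : ℕ) : ℕ :=
  Nat.card {L : Fin n → Fin n → Fin n // IsLatin L ∧ IsReducedLatin L ∧ latinSign L = -1}

/-- `L_n^SE(π)`: Latin squares whose permutation `α₁` (of the first symbol)
is `π` and whose symbol-sign is `+1`. The first symbol is the element of
`Fin n` with value `0`, and `α₁ = π` is expressed by `L i (π i) = first symbol`. -/
noncomputable def numSymEven (n : ℕ) (π : Equiv.Perm (Fin n)) : ℕ :=
  Nat.card {L : Fin n → Fin n → Fin n //
    IsLatin L ∧ (∀ i, (L i (π i)).val = 0) ∧ symbolSign L = 1}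

/-- `L_n^SO(π)`: as `numSymEven` but with symbol-sign `-1`. -/
noncomputable def numSymOdd (n : ℕ) (π : Equiv.Perm (Fin n)) : ℕ :=
  Nat.card {L : Fin n → Fin n → Fin n //
    IsLatin L ∧ (∀ i, (L i (π i)).val = 0) ∧ symbolSign L = -1}

/-- `L_n^CE(π)`: column-even Latin squares with first column `π`. -/
noncomputable def numColEven (n : ℕ) (π : Equiv.Perm (Fin n)) : ℕ :=
  Nat.card {L : Fin n → Fin n → Fin n //
    IsLatin L ∧ (∀ i : Fin n, L i ⟨0, i.pos⟩ = π i) ∧ colSign L = 1}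

/-- `L_n^CO(π)`: column-odd Latin squares with first column `π`. -/
noncomputable def numColOdd (n : ℕ) (π : Equiv.Perm (Fin n)) : ℕ :=
  Nat.card {L : Fin n → Fin n → Fin n //
    IsLatin L ∧ (∀ i : Fin n, L i ⟨0, i.pos⟩ = π i) ∧ colSign L = -1}

/-- `L_n^CE(α, β)`: column-even Latin squares with first row `α` and first column `β`. -/
noncomputable def numColEven₂ (n : ℕ) (α β : Equiv.Perm (Fin n)) : ℕ :=
  Nat.card {L : Fin n → Fin n → Fin n //
    IsLatin L ∧ (∀ j : Fin n, L ⟨0, j.pos⟩ j = α j) ∧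
      (∀ i : Fin n, L i ⟨0, i.pos⟩ = β i) ∧ colSign L = 1}

/-- `L_n^CO(α, β)`: column-odd Latin squares with first row `α` and first column `β`. -/
noncomputable def numColOdd₂ (n : ℕ) (α β : Equiv.Perm (Fin n)) : ℕ :=
  Nat.card {L : Fin n → Fin n → Fin n //
    IsLatin L ∧ (∀ j : Fin n, L ⟨0, j.pos⟩ j = α j) ∧
      (∀ i : Fin n, L i ⟨0, i.pos⟩ = β i) ∧ colSign L = -1}

/-- The `n × n` matrix of indeterminates, over `ℤ`. -/
noncomputable def Xmat (n : ℕ) :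
    Matrix (Fin n) (Fin n) (MvPolynomial (Fin n × Fin n) ℤ) :=
  Matrix.of fun i j => MvPolynomial.X (i, j)

/-- The exponent vector of the square-free monomial `∏_{i,j} X i j`. -/
noncomputable def allOnes (n : ℕ) : (Fin n × Fin n) →₀ ℕ :=
  Finsupp.equivFunOnFinite.symm fun _ => 1

/-- The `(0,1)`-matrix (over `ℤ`) associated to a Boolean matrix. -/
def toInt {n : ℕ} (A : Fin n → Fin n → Bool) : Matrix (Fin n) (Fin n) ℤ :=
  Matrix.of fun i j => if A i j then 1 else 0

/-- `σ₀(A)`: the number of zero entries of a `(0,1)`-matrix. -/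
def sigma0 {n : ℕ} (A : Fin n → Fin n → Bool) : ℕ :=
  (Finset.univ.filter fun p : Fin n × Fin n => A p.1 p.2 = false).card

/-- The conjugate of `L` exchanging the roles of columns and symbols:
`rowInverse L i s = j` iff `L i j = s`. -/
noncomputable def rowInverse {n : ℕ} (L : Fin n → Fin n → Fin n) : Fin n → Fin n → Fin n :=
  fun i s => (permOf fun j => L i j).symm s

theorem permOf_apply {n : ℕ} {f : Fin n → Fin n} (hf : Function.Bijective f) (x : Fin n) :
    permOf f x = f x := by
  rw [permOf, dif_pos hf, Equiv.ofBijective_apply]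

theorem rowInverse_eq_iff {n : ℕ} {L : Fin n → Fin n → Fin n} (hL : IsLatin L)
    (i s j : Fin n) : rowInverse L i s = j ↔ L i j = s := by
  rw [rowInverse, Equiv.symm_apply_eq, permOf_apply (hL.1 i), eq_comm]

theorem isLatin_rowInverse {n : ℕ} {L : Fin n → Fin n → Fin n} (hL : IsLatin L) :
    IsLatin (rowInverse L) := by
  refine ⟨fun i => (permOf fun j => L i j).symm.bijective, fun s => ?_⟩
  refine Finite.injective_iff_bijective.mp fun i i' h => ?_
  have h₁ := (rowInverse_eq_iff hL i s _).mp h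
  have h₂ := (rowInverse_eq_iff hL i' s _).mp rfl
  exact (hL.2 _).1 (h₁.trans h₂.symm)

theorem rowInverse_rowInverse {n : ℕ} {L : Fin n → Fin n → Fin n} (hL : IsLatin L) :
    rowInverse (rowInverse L) = L := by
  funext i s
  rw [rowInverse_eq_iff (isLatin_rowInverse hL), rowInverse_eq_iff hL]

theorem colSign_rowInverse {n : ℕ} (L : Fin n → Fin n → Fin n) :
    colSign (rowInverse L) = symbolSign L := rfl

theorem symbolSign_rowInverse {n : ℕ} {L : Fin n → Fin n → Fin n} (hL : IsLatin L) :
    symbolSign (rowInverse L) = colSign L := by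
  rw [← colSign_rowInverse, rowInverse_rowInverse hL]

/-- Latin squares with prescribed `α₁` and symbol-sign are equinumerous with those with the
same prescribed first column and column-sign. -/
theorem card_symbolSign_eq_card_colSign {n : ℕ} (α : Equiv.Perm (Fin n)) (e : ℤ) :
    Nat.card {L : Fin n → Fin n → Fin n //
      IsLatin L ∧ (∀ i, (L i (α i)).val = 0) ∧ symbolSign L = e} =
    Nat.card {L : Fin n → Fin n → Fin n //
      IsLatin L ∧ (∀ i : Fin n, L i ⟨0, i.pos⟩ = α i) ∧ colSign L = e} :=
  Nat.card_congr
    { toFun := fun L => ⟨rowInverse L.1, isLatin_rowInverse L.2.1,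
        fun i => (rowInverse_eq_iff L.2.1 _ _ _).mpr (Fin.ext (L.2.2.1 i)), L.2.2.2⟩
      invFun := fun L => ⟨rowInverse L.1, isLatin_rowInverse L.2.1,
        fun i => congrArg Fin.val ((rowInverse_eq_iff L.2.1 _ _ _).mpr (L.2.2.1 i)),
        (symbolSign_rowInverse L.2.1).trans L.2.2.2⟩
      left_inv := fun L => Subtype.ext (rowInverse_rowInverse L.2.1)
      right_inv := fun L => Subtype.ext (rowInverse_rowInverse L.2.1) }

/-- `L_n^SE(α) = L_n^CE(α)` and `L_n^SO(α) = L_n^CO(α)`. -/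
theorem numSym_eq_numCol (n : ℕ) (hn : 0 < n) (α : Equiv.Perm (Fin n)) :
    numSymEven n α = numColEven n α ∧ numSymOdd n α = numColOdd n α :=
  ⟨card_symbolSign_eq_card_colSign α 1, card_symbolSign_eq_card_colSign α (-1)⟩
end

section
/- For every positive integer n and every β ∈ Sym(n) with β(1) = 1, L_n^CE(β, id) − L_n^CO(β, id) = L_n^CE(id, id) − L_n^CO(id, id). -/
/-- Permuting the columns of a square array by `β`. -/
def permuteColumns {n : ℕ} (β : Equiv.Perm (Fin n)) :
    (Fin n → Fin n → Fin n) ≃ (Fin n → Fin n → Fin n) :=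
  Equiv.piCongrRight fun _ => β.symm.arrowCongr (Equiv.refl _)

theorem permuteColumns_apply {n : ℕ} (β : Equiv.Perm (Fin n)) (L : Fin n → Fin n → Fin n)
    (i j : Fin n) : permuteColumns β L i j = L i (β j) := rfl

theorem isLatin_permuteColumns_iff {n : ℕ} (β : Equiv.Perm (Fin n))
    (L : Fin n → Fin n → Fin n) : IsLatin (permuteColumns β L) ↔ IsLatin L := by
  refine and_congr (forall_congr' fun i => ?_) ?_
  · exact Function.Bijective.of_comp_iff (L i) β.bijective
  · exact β.forall_congr_left.trans (by simp [permuteColumns_apply])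

theorem colSign_permuteColumns {n : ℕ} (β : Equiv.Perm (Fin n))
    (L : Fin n → Fin n → Fin n) : colSign (permuteColumns β L) = colSign L :=
  Equiv.prod_comp β fun j => (Equiv.Perm.sign (permOf fun i => L i j) : ℤ)

/-- Permuting columns other than the first preserves the number of Latin squares with given
first row, first column and column-sign, up to permuting the prescribed first row. -/
theorem card_latin_first_row_mul {n : ℕ} (hn : 0 < n) (α β γ : Equiv.Perm (Fin n))
    (hβ : β ⟨0, hn⟩ = ⟨0, hn⟩) (s : ℤ) :
    Nat.card {L : Fin n → Fin n → Fin n //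
      IsLatin L ∧ (∀ j : Fin n, L ⟨0, j.pos⟩ j = (α * β) j) ∧
        (∀ i : Fin n, L i ⟨0, i.pos⟩ = γ i) ∧ colSign L = s} =
    Nat.card {L : Fin n → Fin n → Fin n //
      IsLatin L ∧ (∀ j : Fin n, L ⟨0, j.pos⟩ j = α j) ∧
        (∀ i : Fin n, L i ⟨0, i.pos⟩ = γ i) ∧ colSign L = s} := by
  refine (Nat.card_congr ((permuteColumns β).subtypeEquiv fun L => ?_)).symm
  rw [isLatin_permuteColumns_iff, colSign_permuteColumns]
  simp only [permuteColumns_apply, hβ, Equiv.Perm.mul_apply]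
  exact and_congr_right' (and_congr_left'
    (β.forall_congr_right (q := fun j => L ⟨0, j.pos⟩ j = α j)).symm)

/-- For `β` fixing the first point,
`L_n^CE(β, id) - L_n^CO(β, id) = L_n^CE(id, id) - L_n^CO(id, id)`. -/
theorem colDiff_first_row_invariant (n : ℕ) (hn : 0 < n) (β : Equiv.Perm (Fin n))
    (hβ : β ⟨0, hn⟩ = ⟨0, hn⟩) :
    (numColEven₂ n β 1 : ℤ) - numColOdd₂ n β 1
      = (numColEven₂ n 1 1 : ℤ) - numColOdd₂ n 1 1 := by
  have h := card_latin_first_row_mul hn 1 β 1 hβ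
  rw [one_mul] at h
  unfold numColEven₂ numColOdd₂
  rw [h, h]
end
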